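/- Let M ⊆ ℂⁿ be a closed set which is a Carleman continuum, and let E ⊆ ℂⁿ \ M be a closed discrete subset of ℂⁿ (every point of E is isolated in E and E has no accumulation point in ℂⁿ), disjoint from M. Then there exists an entire function φ on ℂⁿ such that φ(z) = 0 for all z ∈ E and φ(x) ≠ 0 for all x ∈ M. -/

import Mathlib

open Set

noncomputable section

/-- Polynomial hull of a compact set `C ⊆ ℂⁿ`. -/
def polyHullCompact {n : ℕ} (C : Set (Fin n → ℂ)) : Set (Fin n → ℂ) :=
  {z | ∀ p : MvPolynomial (Fin n) ℂ,
    ‖MvPolynomial.eval z p‖ ≤ sSup ((fun w => ‖MvPolynomial.eval w p‖) '' C)}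

/-- Polynomial hull of a closed set `X ⊆ ℂⁿ`: union of hulls of compact subsets. -/
def polyHull {n : ℕ} (X : Set (Fin n → ℂ)) : Set (Fin n → ℂ) :=
  ⋃ C ∈ {C : Set (Fin n → ℂ) | IsCompact C ∧ C ⊆ X}, polyHullCompact C

/-- `h(X) = X̂ \ X`. -/
def hHull {n : ℕ} (X : Set (Fin n → ℂ)) : Set (Fin n → ℂ) := polyHull X \ X

/-- A closed set `X` is polynomially convex if `h(X) = ∅`. -/
def IsPolyConvex {n : ℕ} (X : Set (Fin n → ℂ)) : Prop := hHull X = ∅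

/-- `M` has bounded E-hulls if `h(K ∪ M)` is bounded for every compact `K`. -/
def HasBoundedEHulls {n : ℕ} (M : Set (Fin n → ℂ)) : Prop :=
  ∀ K : Set (Fin n → ℂ), IsCompact K → Bornology.IsBounded (hHull (K ∪ M))

/-- `M` is a Carleman continuum: entire functions approximate continuous functions
on `M` in the Whitney `C⁰` topology. -/
def IsCarleman {n : ℕ} (M : Set (Fin n → ℂ)) : Prop :=
  ∀ f : (Fin n → ℂ) → ℂ, ContinuousOn f M →
  ∀ ε : (Fin n → ℂ) → ℝ, ContinuousOn ε M → (∀ x ∈ M, 0 < ε x) →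
  ∃ g : (Fin n → ℂ) → ℂ, Differentiable ℂ g ∧ ∀ x ∈ M, ‖g x - f x‖ < ε x

open Metric in
theorem differentiable_tsum_of_norm_le_on_closedBall {V : Type*} [NormedAddCommGroup V]
    [NormedSpace ℂ V] {f : ℕ → V → ℂ} (hf : ∀ m, Differentiable ℂ (f m))
    (hb : ∀ (m : ℕ) z, ‖z‖ ≤ m → ‖f m z‖ ≤ (1 / 2) ^ m) :
    Differentiable ℂ fun z => ∑' m, f m z := by
  have hgeom : Summable fun m : ℕ => ((1 : ℝ) / 2) ^ m := summable_geometric_two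
  have hsum : ∀ z, Summable fun m => f m z := by
    intro z
    obtain ⟨N, hN⟩ := exists_nat_ge ‖z‖
    refine Summable.of_norm_bounded_eventually_nat hgeom ?_
    filter_upwards [Filter.eventually_ge_atTop N] with m hm
    exact hb m z (hN.trans (by exact_mod_cast hm))
  intro x
  obtain ⟨N, hN⟩ := exists_nat_gt ‖x‖
  have hsplit : (fun z => ∑' m, f m z) =
      fun z => ∑ m ∈ Finset.range (N + 1), f m z + ∑' m, f (m + (N + 1)) z := by
    funext z
    exact ((hsum z).sum_add_tsum_nat_add (N + 1)).symm
  rw [hsplit]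
  refine DifferentiableAt.add (by fun_prop) ?_
  let : NormedSpace ℝ V := NormedSpace.restrictScalars ℝ ℂ V
  refine (hasFDerivAt_tsum_of_isPreconnected (u := fun m : ℕ => 2 * ((1 : ℝ) / 2) ^ m)
    (f' := fun m z => fderiv ℂ (f (m + (N + 1))) z) (hgeom.mul_left 2)
    (isOpen_ball (x := (0 : V)) (ε := N)) (convex_ball (0 : V) (N : ℝ)).isPreconnected
    (fun m z _ => (hf _ z).hasFDerivAt) ?_ (x₀ := x) (by simpa using hN)
    ((summable_nat_add_iff (N + 1)).2 (hsum x)) (by simpa using hN)).differentiableAt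
  intro m z hz
  rw [mem_ball_zero_iff] at hz
  have hbound : ∀ w ∈ ball z 1, ‖f (m + (N + 1)) w‖ ≤ (1 / 2) ^ m := by
    intro w hw
    rw [mem_ball_iff_norm] at hw
    have hw' : ‖w‖ ≤ ((m + (N + 1) : ℕ) : ℝ) := by
      have h1 := norm_le_norm_add_norm_sub' w z
      have h2 : (0 : ℝ) ≤ m := m.cast_nonneg
      push_cast
      linarith
    exact (hb _ w hw').trans
      (pow_le_pow_of_le_one (by norm_num) (by norm_num) (Nat.le_add_right _ _))
  have hmaps : MapsTo (f (m + (N + 1))) (ball z 1)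
      (closedBall (f (m + (N + 1)) z) (2 * (1 / 2) ^ m)) := by
    intro w hw
    rw [mem_closedBall_iff_norm]
    have h1 := hbound w hw
    have h2 := hbound z (mem_ball_self one_pos)
    have h3 := norm_sub_le (f (m + (N + 1)) w) (f (m + (N + 1)) z)
    linarith
  simpa using Complex.norm_fderiv_le_div_of_mapsTo_ball (hf _).differentiableOn hmaps one_pos

section Interpolation

variable {V : Type*} [NormedAddCommGroup V] [NormedSpace ℂ V]

theorem exists_differentiable_eq_one_eq_zero {a b : V} (hab : a ≠ b) :
    ∃ f : V → ℂ, Differentiable ℂ f ∧ f a = 1 ∧ f b = 0 := by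
  obtain ⟨l, -, hl⟩ := exists_dual_vector'' ℂ (a - b)
  have hne : l (a - b) ≠ 0 := by
    rw [hl]
    simpa [sub_eq_zero] using hab
  exact ⟨fun z => l (z - b) / l (a - b), by fun_prop, div_self hne, by simp⟩

variable [ProperSpace V]

theorem exists_differentiable_peak (A : Finset V) {a : V} {r δ : ℝ} (hr : 0 ≤ r)
    (hra : r < ‖a‖) (hδ : 0 < δ) :
    ∃ Q : V → ℂ, Differentiable ℂ Q ∧ Q a = 1 ∧ (∀ b ∈ A, b ≠ a → Q b = 0) ∧
      ∀ z, ‖z‖ ≤ r → ‖Q z‖ ≤ δ := by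
  classical
  have hsep : ∀ b : V, b ≠ a → ∃ f : V → ℂ, Differentiable ℂ f ∧ f a = 1 ∧ f b = 0 :=
    fun b hb => exists_differentiable_eq_one_eq_zero hb.symm
  choose! f hfd hfa hfb using hsep
  let P : V → ℂ := fun z => ∏ b ∈ A.erase a, f b z
  have hPd : Differentiable ℂ P :=
    fun z => (HasFDerivAt.finsetProd fun b hb =>
      (hfd b (Finset.ne_of_mem_erase hb) z).hasFDerivAt).differentiableAt
  obtain ⟨C, hC⟩ := (isCompact_closedBall (0 : V) r).exists_bound_of_continuousOn
    hPd.continuous.continuousOn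
  obtain ⟨l, hl1, hla⟩ := exists_dual_vector'' ℂ a
  have ha : 0 < ‖a‖ := hr.trans_lt hra
  have hlim : Filter.Tendsto (fun N : ℕ => C * (r / ‖a‖) ^ N) Filter.atTop (nhds (C * 0)) :=
    (tendsto_pow_atTop_nhds_zero_of_lt_one (by positivity) ((div_lt_one ha).2 hra)).const_mul C
  rw [mul_zero] at hlim
  obtain ⟨N, hN⟩ := (hlim.eventually (gt_mem_nhds hδ)).exists
  refine ⟨fun z => P z * (l z / l a) ^ N, by fun_prop, ?_, ?_, ?_⟩
  · have hla' : l a ≠ 0 := by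
      rw [← norm_ne_zero_iff, hla]
      simpa using ha.ne'
    have hPa : P a = 1 := Finset.prod_eq_one fun b hb => hfa b (Finset.ne_of_mem_erase hb)
    simp [hPa, div_self hla']
  · intro b hb hba
    have hPb : P b = 0 := Finset.prod_eq_zero (Finset.mem_erase.2 ⟨hba, hb⟩) (hfb b hba)
    simp [hPb]
  · intro z hz
    have hPz : ‖P z‖ ≤ C := hC z (by simpa using hz)
    have hlz : ‖l z / l a‖ ≤ r / ‖a‖ := by
      rw [norm_div, hla]
      simp only [Complex.coe_algebraMap, Complex.norm_real, norm_norm]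
      gcongr
      exact (l.le_of_opNorm_le hl1 z).trans (by simpa using hz)
    rw [norm_mul, norm_pow]
    exact (mul_le_mul hPz (pow_le_pow_left₀ (norm_nonneg _) hlz N) (by positivity)
      ((norm_nonneg _).trans hPz)).trans hN.le

theorem exists_differentiable_interpolation_finset (A : Finset V) {r δ : ℝ} (hr : 0 ≤ r)
    (hδ : 0 < δ) (v : V → ℂ) (hv : ∀ a ∈ A, ‖a‖ ≤ r → v a = 0) :
    ∃ Q : V → ℂ, Differentiable ℂ Q ∧ (∀ a ∈ A, Q a = v a) ∧ ∀ z, ‖z‖ ≤ r → ‖Q z‖ ≤ δ := by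
  classical
  let B := A.filter fun a => r < ‖a‖
  have hη : ∀ a : V, 0 < δ / ((B.card + 1) * (‖v a‖ + 1)) := fun a => by positivity
  choose! q hqd hq1 hq0 hqs using fun (a : V) (ha : r < ‖a‖) =>
    exists_differentiable_peak A hr ha (hη a)
  have hB : ∀ a ∈ B, r < ‖a‖ := fun a ha => (Finset.mem_filter.1 ha).2
  refine ⟨fun z => ∑ a ∈ B, v a * q a z,
    Differentiable.fun_sum fun a ha => (hqd a (hB a ha)).const_mul _, ?_, ?_⟩
  · intro b hb
    by_cases hbr : r < ‖b‖
    · have hbB : b ∈ B := Finset.mem_filter.2 ⟨hb, hbr⟩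
      simp only
      rw [Finset.sum_eq_single_of_mem b hbB fun a ha hab => by
        rw [hq0 a (hB a ha) b hb hab.symm, mul_zero], hq1 b hbr, mul_one]
    · rw [hv b hb (not_lt.1 hbr)]
      refine Finset.sum_eq_zero fun a ha => ?_
      have hab : b ≠ a := fun h => hbr (h ▸ hB a ha)
      rw [hq0 a (hB a ha) b hb hab, mul_zero]
  · intro z hz
    have hterm : ∀ a ∈ B, ‖v a * q a z‖ ≤ δ / (B.card + 1) := by
      intro a ha
      rw [norm_mul]
      calc ‖v a‖ * ‖q a z‖ ≤ (‖v a‖ + 1) * (δ / ((B.card + 1) * (‖v a‖ + 1))) := by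
            gcongr
            · linarith
            · exact hqs a (hB a ha) z hz
        _ = δ / (B.card + 1) := by field_simp
    calc ‖∑ a ∈ B, v a * q a z‖ ≤ B.card • (δ / (B.card + 1)) :=
          (norm_sum_le _ _).trans (Finset.sum_le_card_nsmul _ _ _ hterm)
      _ ≤ δ := by
          rw [nsmul_eq_mul, mul_div_assoc', div_le_iff₀ (by positivity)]
          nlinarith

/-- Entire functions interpolate arbitrary values on a set meeting every ball in a finite set. -/
theorem exists_differentiable_interpolation {E : Set V}
    (hE : ∀ r : ℝ, (E ∩ Metric.closedBall 0 r).Finite) (v : V → ℂ) :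
    ∃ F : V → ℂ, Differentiable ℂ F ∧ ∀ e ∈ E, F e = v e := by
  let P : ℕ → (V → ℂ) → Prop := fun m S =>
    Differentiable ℂ S ∧ ∀ e ∈ E, ‖e‖ ≤ m → S e = v e
  have step : ∀ (m : ℕ) (S : {S // P m S}), ∃ T : {T // P (m + 1) T},
      ∀ z, ‖z‖ ≤ m → ‖T.1 z - S.1 z‖ ≤ (1 / 2) ^ m := by
    rintro m ⟨S, hSd, hS⟩
    obtain ⟨Q, hQd, hQ, hQs⟩ := exists_differentiable_interpolation_finset
      (hE ((m + 1 : ℕ) : ℝ)).toFinset m.cast_nonneg (δ := (1 / 2) ^ m) (by positivity)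
      (fun z => v z - S z) (by
        intro a ha ham
        rw [hS a (by simpa using (((hE _).mem_toFinset).1 ha).1) ham, sub_self])
    refine ⟨⟨fun z => S z + Q z, hSd.add hQd, fun e he hem => ?_⟩, fun z hz => ?_⟩
    · simp only
      rw [hQ e ((hE _).mem_toFinset.2 ⟨he, by simpa using hem⟩)]
      ring
    · simpa using hQs z hz
  choose next hnext using step
  let S : ∀ m, {S // P m S} := fun m =>
    Nat.rec ⟨fun _ => v 0, differentiable_const _, fun e _ he => by
      rw [show e = 0 by simpa using he]⟩ next m
  let f : ℕ → V → ℂ := fun m z => (S (m + 1)).1 z - (S m).1 z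
  have hf : Differentiable ℂ fun z => ∑' m, f m z :=
    differentiable_tsum_of_norm_le_on_closedBall
      (fun m => (S (m + 1)).2.1.sub (S m).2.1) (fun m z hz => hnext m (S m) z hz)
  refine ⟨fun z => (S 0).1 z + ∑' m, f m z, (S 0).2.1.add hf, fun e he => ?_⟩
  obtain ⟨N, hN⟩ := exists_nat_ge ‖e‖
  have hval : ∀ m, N ≤ m → (S m).1 e = v e := fun m hm =>
    (S m).2.2 e he (hN.trans (by exact_mod_cast hm))
  have htsum : ∑' m, f m e = ∑ m ∈ Finset.range N, f m e := by
    refine tsum_eq_sum fun m hm => ?_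
    have hm' : N ≤ m := by simpa using hm
    simp only [f]
    rw [hval m hm', hval (m + 1) (by omega), sub_self]
  simp only
  rw [htsum, Finset.sum_range_sub (fun m => (S m).1 e), hval N le_rfl]
  ring

end Interpolation

theorem finite_inter_closedBall_of_forall_not_accPt {V : Type*} [PseudoMetricSpace V]
    [ProperSpace V] {E : Set V} (hE : ∀ z, ¬ AccPt z (Filter.principal E)) (x : V) (r : ℝ) :
    (E ∩ Metric.closedBall x r).Finite := by
  by_contra h
  obtain ⟨z, -, hz⟩ := Set.Infinite.exists_accPt_of_subset_isCompact h
    (isCompact_closedBall x r) inter_subset_right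
  exact hE z (hz.mono (Filter.principal_mono.2 inter_subset_left))

/-- A nonempty closed discrete subset of `ℂⁿ` is the common zero set of `n + 1` entire functions. -/
theorem exists_entire_common_zeros_eq {n : ℕ} {E : Set (Fin n → ℂ)} (hne : E.Nonempty)
    (hE : ∀ z : Fin n → ℂ, ¬ AccPt z (Filter.principal E)) :
    ∃ h : Option (Fin n) → (Fin n → ℂ) → ℂ, (∀ j, Differentiable ℂ (h j)) ∧
      ∀ z, (∀ j, h j z = 0) ↔ z ∈ E := by
  have hfin := finite_inter_closedBall_of_forall_not_accPt hE 0
  have hcount : E.Countable := by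
    have hcover : E = ⋃ m : ℕ, E ∩ Metric.closedBall 0 (m : ℝ) := by
      rw [← inter_iUnion, Metric.iUnion_closedBall_nat, inter_univ]
    rw [hcover]
    exact countable_iUnion fun m => (hfin m).countable
  obtain ⟨g, hg⟩ := hcount.exists_eq_range hne
  have hgE : ∀ k, g k ∈ E := fun k => hg ▸ mem_range_self k
  have hsurj : ∀ e ∈ E, ∃ k, g k = e := fun e he => by rwa [hg] at he
  choose! c hc using hsurj
  obtain ⟨F, hFd, hF⟩ := exists_differentiable_interpolation hfin fun e => (c e : ℂ)
  have hnat : ∀ r : ℝ, (range ((↑) : ℕ → ℂ) ∩ Metric.closedBall 0 r).Finite := by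
    intro r
    obtain ⟨N, hN⟩ := exists_nat_ge r
    refine ((finite_Iic N).image ((↑) : ℕ → ℂ)).subset ?_
    rintro _ ⟨⟨k, rfl⟩, hk⟩
    refine ⟨k, ?_, rfl⟩
    have hk' : (k : ℝ) ≤ r := by simpa using hk
    exact_mod_cast hk'.trans hN
  have hL : ∀ i : Fin n, ∃ L : ℂ → ℂ, Differentiable ℂ L ∧ ∀ k : ℕ, L k = g k i := by
    intro i
    obtain ⟨L, hLd, hL⟩ := exists_differentiable_interpolation hnat
      fun w => g (Function.invFun ((↑) : ℕ → ℂ) w) i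
    refine ⟨L, hLd, fun k => ?_⟩
    rw [hL k (mem_range_self k), Function.leftInverse_invFun Nat.cast_injective k]
  choose L hLd hL using hL
  refine ⟨fun j z => j.elim (Complex.Gamma (-F z))⁻¹ fun i => z i - L i (F z), ?_, fun z => ?_⟩
  · rintro (_ | i)
    · exact Complex.differentiable_one_div_Gamma.comp hFd.neg
    · exact (differentiable_apply i).sub ((hLd i).comp hFd)
  · simp only [Option.forall, Option.elim_none, Option.elim_some, inv_eq_zero,
      Complex.Gamma_eq_zero_iff, neg_inj, sub_eq_zero]
    constructor
    · rintro ⟨⟨k, hk⟩, hz⟩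
      have hzg : z = g k := funext fun i => by rw [hz i, hk, hL]
      exact hzg ▸ hgE k
    · intro hz
      refine ⟨⟨c z, hF z hz⟩, fun i => ?_⟩
      rw [hF z hz, hL, hc z hz]

/-- On a Carleman continuum, finitely many entire functions without common zeros have an entire
linear combination without zeros. -/
theorem IsCarleman.exists_entire_combination_ne_zero {n : ℕ} {M : Set (Fin n → ℂ)}
    (hM : IsCarleman M) {ι : Type*} [Fintype ι] {h : ι → (Fin n → ℂ) → ℂ}
    (hd : ∀ j, Differentiable ℂ (h j)) (hne : ∀ x ∈ M, ∃ j, h j x ≠ 0) :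
    ∃ g : ι → (Fin n → ℂ) → ℂ, (∀ j, Differentiable ℂ (g j)) ∧
      ∀ x ∈ M, ∑ j, h j x * g j x ≠ 0 := by
  have hc : ∀ j, Continuous (h j) := fun j => (hd j).continuous
  let H : (Fin n → ℂ) → ℂ := fun x => ∑ j, h j x * starRingEnd ℂ (h j x)
  have hHne : ∀ x ∈ M, H x ≠ 0 := by
    intro x hx
    obtain ⟨j, hj⟩ := hne x hx
    have hpos : 0 < ∑ j, ‖h j x‖ ^ 2 :=
      Finset.sum_pos' (fun _ _ => by positivity) ⟨j, Finset.mem_univ j, by positivity⟩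
    have hHx : H x = ((∑ j, ‖h j x‖ ^ 2 : ℝ) : ℂ) := by
      simp [H, Complex.mul_conj']
    rw [hHx]
    exact_mod_cast hpos.ne'
  let f : ι → (Fin n → ℂ) → ℂ := fun j x => starRingEnd ℂ (h j x) / H x
  have hf : ∀ j, ContinuousOn (f j) M := fun j =>
    ContinuousOn.div (by fun_prop) (by fun_prop) hHne
  have hpos : ∀ x, 0 < 1 + ∑ j, ‖h j x‖ := fun x => by positivity
  choose g hgd hg using fun j => hM (f j) (hf j) (fun x => (1 + ∑ j, ‖h j x‖)⁻¹)
    (ContinuousOn.inv₀ (by fun_prop) fun x _ => (hpos x).ne') fun x _ => inv_pos.2 (hpos x)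
  refine ⟨g, hgd, fun x hx h0 => ?_⟩
  have hone : ∑ j, h j x * f j x = 1 := by
    simp only [f, mul_div_assoc', ← Finset.sum_div]
    exact div_self (hHne x hx)
  have hlt : ‖∑ j, h j x * (g j x - f j x)‖ < 1 := by
    calc ‖∑ j, h j x * (g j x - f j x)‖ ≤ ∑ j, ‖h j x‖ * (1 + ∑ j, ‖h j x‖)⁻¹ := by
          refine norm_sum_le_of_le _ fun j _ => ?_
          rw [norm_mul]
          gcongr
          exact (hg j x hx).le
      _ < 1 := by
          rw [← Finset.sum_mul, ← div_eq_mul_inv, div_lt_one (hpos x)]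
          linarith
  simp [mul_sub, Finset.sum_sub_distrib, h0, hone] at hlt

/-- an entire function vanishing exactly on a closed discrete set,
nonvanishing on a disjoint Carleman continuum. -/
theorem entire_vanishing_on_discrete_nonvanishing_on_carleman {n : ℕ}
    (M E : Set (Fin n → ℂ)) (hMclosed : IsClosed M) (hMcar : IsCarleman M)
    (hEclosed : IsClosed E)
    (hEdisc : ∀ z : Fin n → ℂ, ¬ AccPt z (Filter.principal E))
    (hdisj : Disjoint E M) :
    ∃ φ : (Fin n → ℂ) → ℂ, Differentiable ℂ φ ∧
      (∀ z ∈ E, φ z = 0) ∧ (∀ x ∈ M, φ x ≠ 0) := by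
  rcases E.eq_empty_or_nonempty with rfl | hne
  · exact ⟨fun _ => 1, differentiable_const _, by simp, by simp⟩
  obtain ⟨h, hd, hzero⟩ := exists_entire_common_zeros_eq hne hEdisc
  obtain ⟨g, hgd, hg⟩ := hMcar.exists_entire_combination_ne_zero hd fun x hx => by
    by_contra! hx0
    exact hdisj.ne_of_mem ((hzero x).1 hx0) hx rfl
  refine ⟨fun z => ∑ j, h j z * g j z,
    Differentiable.fun_sum fun j _ => (hd j).mul (hgd j), fun z hz => ?_, hg⟩
  exact Finset.sum_eq_zero fun j _ => by rw [(hzero z).2 hz j, zero_mul]
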